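/- arXiv:1901.05080 — 3 statements merged into one kernel-verified Lean document; each statement's English description precedes it below -/
import Mathlib

section
/- Let r and s be coprime positive integers with s > 1. Then the set R_+(r/s) = { Σ_{k=0}^{m} a_k · C(r/s, k) : m ∈ ℕ, a_0, …, a_m ∈ ℤ_{≥0} } of values at r/s of nonnegative integer linear combinations of generalized binomial coefficients is equal to the subring ℤ[1/s] = { n / s^m : n ∈ ℤ, m ∈ ℤ_{≥0} } of ℚ. -/
/-- The generalized binomial coefficient `C(x, k) = x(x-1)⋯(x-k+1)/k!`. -/
def gchoose (x : ℚ) (k : ℕ) : ℚ := (∏ i ∈ Finset.range k, (x - i)) / (Nat.factorial k)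

/-- The set of values at `x` of nonnegative integer linear combinations of
generalized binomial coefficients. -/
def Rplus (x : ℚ) : Set ℚ :=
  {y | ∃ (m : ℕ) (a : ℕ → ℕ), y = ∑ k ∈ Finset.range (m + 1), (a k : ℚ) * gchoose x k}

/-- The subring `ℤ[1/s]` of `ℚ`, as a set. -/
def zOneOver (s : ℕ) : Set ℚ := {y | ∃ (n : ℤ) (m : ℕ), y = (n : ℚ) / (s : ℚ) ^ m}

/-- `Rplus x` is closed under addition. -/
theorem add_mem_Rplus {x y z : ℚ} (hy : y ∈ Rplus x) (hz : z ∈ Rplus x) : y + z ∈ Rplus x := by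
  obtain ⟨m, a, rfl⟩ := hy
  obtain ⟨n, b, rfl⟩ := hz
  have extend : ∀ (p q : ℕ) (c : ℕ → ℕ), p ≤ q →
      ∑ k ∈ Finset.range (p + 1), (c k : ℚ) * gchoose x k =
        ∑ k ∈ Finset.range (q + 1), ((if k < p + 1 then c k else 0 : ℕ) : ℚ) * gchoose x k := by
    intro p q c hpq
    rw [← Finset.sum_subset (Finset.range_subset_range.2 (Nat.succ_le_succ hpq))]
    · refine Finset.sum_congr rfl fun k hk => ?_
      rw [if_pos (Finset.mem_range.1 hk)]
    · intro k _ hk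
      rw [if_neg (by simpa using hk)]
      simp
  refine ⟨max m n, fun k => (if k < m + 1 then a k else 0) + (if k < n + 1 then b k else 0), ?_⟩
  rw [extend m _ a (le_max_left m n), extend n _ b (le_max_right m n), ← Finset.sum_add_distrib]
  refine Finset.sum_congr rfl fun k _ => ?_
  push_cast
  ring

/-- Natural multiples of generalized binomial coefficients lie in `Rplus x`. -/
theorem natCast_mul_gchoose_mem_Rplus (x : ℚ) (n k : ℕ) : (n : ℚ) * gchoose x k ∈ Rplus x := by
  refine ⟨k, fun j => if j = k then n else 0, ?_⟩
  rw [Finset.sum_eq_single k]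
  · simp
  · intro j _ hj
    simp [hj]
  · simp

theorem natCast_mem_Rplus (x : ℚ) (n : ℕ) : (n : ℚ) ∈ Rplus x := by
  simpa [gchoose] using natCast_mul_gchoose_mem_Rplus x n 0

theorem natCast_mul_mem_Rplus {x y : ℚ} (n : ℕ) (hy : y ∈ Rplus x) : (n : ℚ) * y ∈ Rplus x := by
  obtain ⟨m, a, rfl⟩ := hy
  refine ⟨m, fun k => n * a k, ?_⟩
  rw [Finset.mul_sum]
  refine Finset.sum_congr rfl fun k _ => ?_
  push_cast
  ring

theorem prod_div_sub_eq (r s k : ℕ) (hs : s ≠ 0) :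
    ∏ i ∈ Finset.range k, ((r : ℚ) / s - i) =
      ((∏ i ∈ Finset.range k, ((r : ℤ) - i * s) : ℤ) : ℚ) / (s : ℚ) ^ k := by
  have hs' : (s : ℚ) ≠ 0 := by exact_mod_cast hs
  push_cast
  rw [← Finset.card_range k, ← Finset.prod_const, Finset.card_range, ← Finset.prod_div_distrib]
  refine Finset.prod_congr rfl fun i _ => ?_
  field_simp

theorem prod_div_pow_mem_Rplus (r s k : ℕ) (hs : s ≠ 0) :
    ((∏ i ∈ Finset.range k, ((r : ℤ) - i * s) : ℤ) : ℚ) / (s : ℚ) ^ k ∈ Rplus ((r : ℚ) / s) := by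
  have h := natCast_mul_gchoose_mem_Rplus ((r : ℚ) / s) k.factorial k
  rwa [gchoose, mul_div_cancel₀ _ (by exact_mod_cast k.factorial_ne_zero),
    prod_div_sub_eq r s k hs] at h

theorem isCoprime_prod_sub_mul {r s : ℕ} (hco : Nat.Coprime r s) (k : ℕ) :
    IsCoprime (∏ i ∈ Finset.range k, ((r : ℤ) - i * s)) (s : ℤ) := by
  refine IsCoprime.prod_left fun i _ => ?_
  have h : IsCoprime (r : ℤ) (s : ℤ) := Nat.isCoprime_iff_coprime.2 hco
  simpa [sub_eq_add_neg] using h.add_mul_right_left (-(i : ℤ))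

/-- A divisor of `k!` prime to `s` divides `∏ i < k, (r - i s)`. -/
theorem dvd_prod_sub_mul (r s k : ℕ) {v : ℤ} (hv : v ∣ (k.factorial : ℤ))
    (hvs : IsCoprime v (s : ℤ)) : v ∣ ∏ i ∈ Finset.range k, ((r : ℤ) - i * s) := by
  obtain ⟨a, t, hat⟩ := hvs
  have hcongr : ∏ i ∈ Finset.range k, ((r : ℤ) - i * s) ≡
      ∏ i ∈ Finset.range k, (-(s : ℤ) * (-(t * r) + i)) [ZMOD v] := by
    refine Int.ModEq.prod fun i _ => ?_
    refine Int.modEq_iff_dvd.2 ⟨-(a * r), ?_⟩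
    linear_combination (r : ℤ) * hat
  refine (Int.ModEq.dvd_iff hcongr).2 ?_
  rw [Finset.prod_mul_distrib]
  exact (hv.trans (Nat.factorial_coe_dvd_prod k _)).mul_left _

/-- A positive integer is the product of a divisor of a power of `s` and an integer prime to `s`. -/
theorem exists_eq_mul_dvd_pow_coprime (s n : ℕ) (hn : n ≠ 0) :
    ∃ u v N : ℕ, n = u * v ∧ u ∣ s ^ N ∧ Nat.Coprime v s := by
  induction n using Nat.strong_induction_on with
  | _ n ih =>
    by_cases hns : Nat.Coprime n s
    · exact ⟨1, n, 0, by simp, by simp, hns⟩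
    · obtain ⟨n', hn'⟩ := Nat.gcd_dvd_left n s
      have hn'0 : n' ≠ 0 := by
        rintro rfl
        exact hn (by simpa using hn')
      have hg : 1 < Nat.gcd n s :=
        lt_of_le_of_ne (Nat.gcd_pos_of_pos_left s (Nat.pos_of_ne_zero hn)) (Ne.symm hns)
      have hlt : n' < n := by
        conv_rhs => rw [hn']
        exact (Nat.lt_mul_iff_one_lt_left (Nat.pos_of_ne_zero hn'0)).2 hg
      obtain ⟨u, v, N, huv, hu, hv⟩ := ih n' hlt hn'0
      refine ⟨u * Nat.gcd n s, v, N + 1, ?_, ?_, hv⟩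
      · conv_lhs => rw [hn', huv]
        ring
      · rw [pow_succ]
        exact mul_dvd_mul hu (Nat.gcd_dvd_right n s)

theorem gchoose_mem_zOneOver (r s k : ℕ) (hs : s ≠ 0) :
    gchoose ((r : ℚ) / s) k ∈ zOneOver s := by
  have hs' : (s : ℚ) ≠ 0 := by exact_mod_cast hs
  obtain ⟨u, v, N, huv, ⟨w, hw⟩, hv⟩ :=
    exists_eq_mul_dvd_pow_coprime s k.factorial k.factorial_ne_zero
  obtain ⟨q, hq⟩ := dvd_prod_sub_mul r s k (v := v)
    (by rw [huv]; exact_mod_cast Dvd.intro_left u rfl) (Nat.isCoprime_iff_coprime.2 hv)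
  have huv0 : u * v ≠ 0 := huv ▸ k.factorial_ne_zero
  have hu0 : (u : ℚ) ≠ 0 := by exact_mod_cast left_ne_zero_of_mul huv0
  have hv0 : (v : ℚ) ≠ 0 := by exact_mod_cast right_ne_zero_of_mul huv0
  have hw' : (s : ℚ) ^ N = u * w := by exact_mod_cast hw
  have hw0 : (w : ℚ) ≠ 0 := right_ne_zero_of_mul (hw' ▸ pow_ne_zero N hs')
  refine ⟨q * w, k + N, ?_⟩
  rw [gchoose, prod_div_sub_eq r s k hs, hq, huv, pow_add, hw']
  push_cast
  field_simp

theorem add_mem_zOneOver {s : ℕ} (hs : s ≠ 0) {y z : ℚ} (hy : y ∈ zOneOver s)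
    (hz : z ∈ zOneOver s) : y + z ∈ zOneOver s := by
  have hs' : (s : ℚ) ≠ 0 := by exact_mod_cast hs
  obtain ⟨a, m, rfl⟩ := hy
  obtain ⟨b, n, rfl⟩ := hz
  refine ⟨a * s ^ n + b * s ^ m, m + n, ?_⟩
  push_cast
  field_simp
  ring

theorem Rplus_subset_zOneOver (r s : ℕ) (hs : s ≠ 0) :
    Rplus ((r : ℚ) / s) ⊆ zOneOver s := by
  rintro _ ⟨m, a, rfl⟩
  refine Finset.sum_induction _ (· ∈ zOneOver s) (fun _ _ => add_mem_zOneOver hs)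
    ⟨0, 0, by simp⟩ fun k _ => ?_
  obtain ⟨n, l, h⟩ := gchoose_mem_zOneOver r s k hs
  exact ⟨a k * n, l, by rw [h]; push_cast; ring⟩

/-- Some product `∏ i < k, (r - i s)` is negative. -/
theorem exists_prod_sub_mul_neg {r s : ℕ} (hs : 1 < s) (hco : Nat.Coprime r s) :
    ∃ k : ℕ, ∏ i ∈ Finset.range k, ((r : ℤ) - i * s) < 0 := by
  refine ⟨r / s + 2, ?_⟩
  rw [Finset.prod_range_succ]
  refine mul_neg_of_pos_of_neg (Finset.prod_pos fun i hi => ?_) ?_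
  · have hle : i * s ≤ r :=
      (Nat.le_div_iff_mul_le (by omega)).1 (Nat.lt_succ_iff.1 (Finset.mem_range.1 hi))
    have hne : i * s ≠ r := by
      rintro rfl
      exact hs.ne' (Nat.Coprime.eq_one_of_dvd hco.symm (Dvd.intro_left i rfl))
    have : i * s < r := lt_of_le_of_ne hle hne
    zify at this
    linarith
  · have : r < (r / s + 1) * s := by
      rw [mul_comm]; exact Nat.lt_mul_div_succ r (by omega)
    zify at this
    push_cast
    linarith

theorem intCast_mem_Rplus {r s : ℕ} (hs : 1 < s) (hco : Nat.Coprime r s) (n : ℤ) :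
    (n : ℚ) ∈ Rplus ((r : ℚ) / s) := by
  have hs' : (s : ℚ) ≠ 0 := by exact_mod_cast (by omega : s ≠ 0)
  obtain ⟨k, hk⟩ := exists_prod_sub_mul_neg hs hco
  have hA := natCast_mul_mem_Rplus (s ^ k) (prod_div_pow_mem_Rplus r s k (by omega))
  set A : ℤ := ∏ i ∈ Finset.range k, ((r : ℤ) - i * s)
  rw [Nat.cast_pow, mul_div_cancel₀ _ (pow_ne_zero k hs')] at hA
  have hsum := add_mem_Rplus (natCast_mul_mem_Rplus n.natAbs hA)
    (natCast_mem_Rplus ((r : ℚ) / s) (n - n.natAbs * A).toNat)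
  have hnonneg : 0 ≤ n - n.natAbs * A := by
    have : (n.natAbs : ℤ) = |n| := Int.natCast_natAbs n
    rw [this]
    nlinarith [neg_abs_le n, abs_nonneg n]
  have hcast : (((n - n.natAbs * A).toNat : ℕ) : ℚ) = ((n - n.natAbs * A : ℤ) : ℚ) := by
    exact_mod_cast Int.toNat_of_nonneg hnonneg
  rw [hcast] at hsum
  convert hsum using 1
  rw [Int.cast_sub, Int.cast_mul, Int.cast_natCast]
  ring

theorem zOneOver_subset_Rplus {r s : ℕ} (hs : 1 < s) (hco : Nat.Coprime r s) :
    zOneOver s ⊆ Rplus ((r : ℚ) / s) := by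
  rintro _ ⟨n, m, rfl⟩
  have hs' : (s : ℚ) ≠ 0 := by exact_mod_cast (by omega : s ≠ 0)
  have hy := prod_div_pow_mem_Rplus r s m (by omega)
  obtain ⟨u, v, huv⟩ := (isCoprime_prod_sub_mul hco m).pow_right (n := m)
  set A : ℤ := ∏ i ∈ Finset.range m, ((r : ℤ) - i * s)
  have hpos : (s : ℤ) ^ m ≠ 0 := pow_ne_zero m (by omega)
  obtain ⟨w, hw⟩ := Int.eq_ofNat_of_zero_le (Int.emod_nonneg (n * u) hpos)
  have hdiv := Int.emod_add_mul_ediv (n * u) ((s : ℤ) ^ m)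
  rw [hw] at hdiv
  convert add_mem_Rplus (natCast_mul_mem_Rplus w hy)
    (intCast_mem_Rplus hs hco (n * v + A * (n * u / (s : ℤ) ^ m))) using 1
  generalize n * u / (s : ℤ) ^ m = q at *
  have key : (n : ℚ) = w * A + (n * v + A * q) * (s : ℚ) ^ m := by
    have : n = w * A + (n * v + A * q) * (s : ℤ) ^ m := by
      linear_combination (-n) * huv - A * hdiv
    exact_mod_cast this
  push_cast
  field_simp
  linear_combination key

theorem stmt_3 (r s : ℕ) (hr : 0 < r) (hs : 1 < s) (hco : Nat.Coprime r s) :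
    Rplus ((r : ℚ) / (s : ℚ)) = zOneOver s :=
  (Rplus_subset_zOneOver r s (by omega)).antisymm (zOneOver_subset_Rplus hs hco)
end

section
/- For all natural numbers i and j there exist nonnegative integers c_0, c_1, …, c_{i+j} such that for every rational number x one has C(x, i) · C(x, j) = Σ_{k=0}^{i+j} c_k · C(x, k). (Explicitly, c_k may be taken to be the coefficient of z^i w^j in the polynomial (z + w + zw)^k, which is a nonnegative integer.) -/
/-- `gchoose` agrees with the binomial coefficient of the binomial ring `ℚ`. -/
theorem gchoose_eq_ring_choose (x : ℚ) (k : ℕ) : gchoose x k = Ring.choose x k := by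
  rw [gchoose, Ring.choose_eq_smul, smul_eq_mul, div_eq_inv_mul,
    ← descPochhammer_eval_eq_prod_range, ← descPochhammer_map (Int.castRingHom ℚ),
    Polynomial.eval_map, ← Polynomial.eval₂_smulOneHom_eq_smeval]
  congr 2
  exact Subsingleton.elim _ _

/-- Expand `C(x, j)` around `x = (x - i) + i` by Vandermonde and absorb `C(x, i)` in each term. -/
theorem Ring.choose_mul_choose_eq_sum {R : Type*} [CommRing R] [BinomialRing R]
    (x : R) (i j : ℕ) :
    Ring.choose x i * Ring.choose x j =
      ∑ m ∈ Finset.range (j + 1),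
        (((i + m).choose i * i.choose (j - m) : ℕ) : R) * Ring.choose x (i + m) := by
  have vandermonde := Ring.add_choose_eq j (Commute.all (x - i) (i : R))
  rw [sub_add_cancel, Finset.Nat.sum_antidiagonal_eq_sum_range_succ
    (fun a b => Ring.choose (x - i) a * Ring.choose (i : R) b)] at vandermonde
  rw [vandermonde, Finset.mul_sum]
  refine Finset.sum_congr rfl fun m _ => ?_
  have absorb := Ring.choose_smul_choose x (Nat.le_add_right i m)
  rw [Nat.add_sub_cancel_left, nsmul_eq_mul] at absorb
  rw [Ring.choose_natCast, Nat.cast_mul]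
  linear_combination -(i.choose (j - m) : R) * absorb

theorem stmt_4 (i j : ℕ) :
    ∃ c : ℕ → ℕ, ∀ x : ℚ,
      gchoose x i * gchoose x j =
        ∑ k ∈ Finset.range (i + j + 1), (c k : ℚ) * gchoose x k := by
  refine ⟨fun k => k.choose i * i.choose (j - (k - i)), fun x => ?_⟩
  simp only [gchoose_eq_ring_choose]
  rw [Ring.choose_mul_choose_eq_sum, add_assoc, Finset.sum_range_add _ i (j + 1),
    Finset.sum_eq_zero (s := Finset.range i), zero_add]
  · simp only [Nat.add_sub_cancel_left]
  · intro k hk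
    simp [Nat.choose_eq_zero_of_lt (Finset.mem_range.mp hk)]
end

section
/- Let r and s be coprime positive integers with s > 1, let q be a prime number not dividing s, and let k be a positive integer. Then the product P = ∏_{j=0}^{k−1} (r − j·s) is a nonzero integer, and the q-adic valuation of k! is at most the q-adic valuation of P; that is, the multiplicity of q in the prime factorization of k! is at most the multiplicity of q in the prime factorization of |∏_{j=0}^{k−1} (r − j·s)|. -/
/-- An integer dividing `k !` and coprime to `s` divides every product of `k` consecutive terms
of an arithmetic progression with difference `s`. -/
theorem dvd_prod_range_sub_mul_of_dvd_factorial {r s d : ℤ} {k : ℕ} (hds : IsCoprime s d)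
    (hd : d ∣ (k.factorial : ℤ)) : d ∣ ∏ j ∈ Finset.range k, (r - (j : ℤ) * s) := by
  obtain ⟨t, u, htu⟩ := hds
  have hterm : ∀ j ∈ Finset.range k,
      r - (j : ℤ) * s ≡ -s * (-(r * t) + (j : ℤ)) [ZMOD d] := fun j _ ↦ by
    refine (Int.modEq_iff_dvd.2 ⟨r * u, ?_⟩).symm
    linear_combination (-r) * htu
  have hprod := Int.ModEq.prod hterm
  rw [Finset.prod_mul_distrib] at hprod
  exact hprod.dvd_iff.2
    ((hd.trans (Nat.factorial_coe_dvd_prod k _)).mul_left _)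

/-- No term of `r, r - s, r - 2s, …` vanishes when `r` and `s > 1` are coprime. -/
theorem prod_range_sub_mul_ne_zero {r s : ℕ} (hs : 1 < s) (hco : Nat.Coprime r s) (k : ℕ) :
    ∏ j ∈ Finset.range k, ((r : ℤ) - (j : ℤ) * (s : ℤ)) ≠ 0 := by
  refine Finset.prod_ne_zero_iff.2 fun j _ h ↦ ?_
  have hrj : r = j * s := by exact_mod_cast sub_eq_zero.1 h
  exact hs.ne' (Nat.eq_one_of_dvd_coprimes hco (hrj ▸ dvd_mul_left s j) dvd_rfl)

theorem stmt_5 (r s : ℕ) (hr : 0 < r) (hs : 1 < s) (hco : Nat.Coprime r s)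
    (q : ℕ) (hq : q.Prime) (hqs : ¬ q ∣ s) (k : ℕ) (hk : 0 < k) :
    (∏ j ∈ Finset.range k, ((r : ℤ) - (j : ℤ) * (s : ℤ))) ≠ 0 ∧
      padicValNat q (Nat.factorial k) ≤
        padicValInt q (∏ j ∈ Finset.range k, ((r : ℤ) - (j : ℤ) * (s : ℤ))) := by
  have hne := prod_range_sub_mul_ne_zero hs hco k
  have : Fact q.Prime := ⟨hq⟩
  refine ⟨hne, ((padicValInt_dvd_iff _ _).1 ?_).resolve_left hne⟩
  have hcop : IsCoprime (s : ℤ) (q : ℤ) :=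
    Nat.isCoprime_iff_coprime.2 ((hq.coprime_iff_not_dvd.2 hqs).symm)
  refine dvd_prod_range_sub_mul_of_dvd_factorial hcop.pow_right ?_
  exact_mod_cast (pow_padicValNat_dvd : q ^ padicValNat q k.factorial ∣ k.factorial)
end
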